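/- Let q be an odd prime and n > k ≥ 1 with n ≥ 3. If B is a k-blocking set of PG(F_q^n) that does not contain the point set of any k-space (i.e., there is no (k+1)-dimensional F_q-linear subspace W of F_q^n with {⟨w⟩ : w ∈ W, w ≠ 0} ⊆ B), then |B| ≥ (q^{k+1} − 1)/(q − 1) + q^{k−1}·(q + 1)/2. -/

import Mathlib

open Finset

/-- `S ∈ 𝒯_{k,q}`: there is a positive integer `Δ` such that for every natural number `N`
with `Ω(N) ≤ k` and `gcd(N, Δ) = 1`, some `s ∈ S` is a `q`-th power modulo `N`. -/
def MemT (q k : ℕ) (S : Set ℤ) : Prop :=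
  ∃ Δ : ℕ, 0 < Δ ∧ ∀ N : ℕ, 0 < N → N.primeFactorsList.length ≤ k → Nat.Coprime N Δ →
    ∃ s ∈ S, ∃ x : ℤ, (N : ℤ) ∣ x ^ q - s

/-- `s` is a perfect `q`-th power of an integer. -/
def IsPerfectPow (q : ℕ) (s : ℤ) : Prop := ∃ r : ℤ, r ^ q = s

/-- The finite set of primes dividing `∏_{s ∈ S} rad_q(|s|)`, i.e. the primes `p` such that
`q ∤ v_p(|s|)` for some `s ∈ S`. -/
def qPrimes (q : ℕ) (S : Finset ℤ) : Finset ℕ :=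
  S.sup fun s => s.natAbs.primeFactors.filter fun p => ¬ q ∣ s.natAbs.factorization p

/-- The vector `(v_{p_1}(|u|) mod q, …, v_{p_n}(|u|) mod q)` where `p_1 < … < p_n`
is the increasing enumeration of the finite set of primes `P`. -/
def vecOf (q : ℕ) (P : Finset ℕ) (u : ℤ) : Fin P.card → ZMod q :=
  fun i => ((u.natAbs.factorization (P.orderIsoOfFin rfl i).1 : ℕ) : ZMod q)

/-- The projective point `⟨v⟩` of `PG(F_q^n)` spanned by a vector `v`. -/
def projPoint {q n : ℕ} (v : Fin n → ZMod q) : Submodule (ZMod q) (Fin n → ZMod q) :=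
  Submodule.span (ZMod q) {v}

/-- The set of projective points associated with `S` in `PG(F_q^n)`,
`n` being the number of distinct primes dividing `∏_{s ∈ S} rad_q(|s|)`. -/
def assocPoints (q : ℕ) (S : Finset ℤ) :
    Set (Submodule (ZMod q) (Fin (qPrimes q S).card → ZMod q)) :=
  {P | ∃ s ∈ S, P = projPoint (vecOf q (qPrimes q S) s)}

/-- `B` is a `k`-blocking set of `PG(F_q^n)`: every subspace of codimension `k`
contains a nonzero vector spanning a point of `B`. -/
def IsBlockingSet (q n k : ℕ) (B : Set (Submodule (ZMod q) (Fin n → ZMod q))) : Prop :=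
  ∀ W : Submodule (ZMod q) (Fin n → ZMod q), Module.finrank (ZMod q) W = n - k →
    ∃ v ∈ W, v ≠ 0 ∧ projPoint v ∈ B

/-- `B` is (the point set of) a `k`-space of `PG(F_q^n)`. -/
def IsKSpace (q n k : ℕ) (B : Set (Submodule (ZMod q) (Fin n → ZMod q))) : Prop :=
  ∃ W : Submodule (ZMod q) (Fin n → ZMod q), Module.finrank (ZMod q) W = k + 1 ∧
    B = {P | ∃ v ∈ W, v ≠ 0 ∧ P = projPoint v}

/-- `S` and `T` are geometrically `q`-equivalent: some element of `PGL(n, q)` maps the point set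
associated with `S` onto the point set associated with `T`, where the points are computed with
respect to all the primes dividing `(∏_{s ∈ S} rad_q(|s|)) ⬝ (∏_{t ∈ T} rad_q(|t|))`. -/
def GeomEquiv (q : ℕ) (S T : Finset ℤ) : Prop :=
  ∃ Ψ : (Fin (qPrimes q (S ∪ T)).card → ZMod q) ≃ₗ[ZMod q]
        (Fin (qPrimes q (S ∪ T)).card → ZMod q),
    (Submodule.map Ψ.toLinearMap) ''
        {P | ∃ s ∈ S, P = projPoint (vecOf q (qPrimes q (S ∪ T)) s)} =
      {P | ∃ t ∈ T, P = projPoint (vecOf q (qPrimes q (S ∪ T)) t)}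

/-- The set of squares of `F_qˣ` together with `0`. -/
def Q0 (q : ℕ) : Set (ZMod q) := {x | (∃ a : ZMod q, a ≠ 0 ∧ a ^ 2 = x) ∨ x = 0}

section Poly
open Polynomial

theorem hb_dvd_mul_derivative {F : Type*} [Field F] (f p : F[X]) (hf : f.Splits) (hf0 : f ≠ 0)
    (hp : ∀ c, f.eval c = 0 → p.eval c = 0) : f ∣ p * derivative f := by
  classical
  by_cases h0 : p * derivative f = 0
  · rw [h0]; exact dvd_zero _
  rw [hf.dvd_iff_roots_le_roots hf0 h0, Multiset.le_iff_count]
  intro c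
  rw [count_roots, count_roots]
  rw [le_rootMultiplicity_iff h0]
  rcases Nat.eq_zero_or_pos (rootMultiplicity c f) with h | h
  · rw [h, pow_zero]; exact one_dvd _
  · have hr : f.eval c = 0 := (rootMultiplicity_pos hf0).1 h
    have h1 : (X - C c) ∣ p := dvd_iff_isRoot.2 (hp c hr)
    have h2 : (X - C c) ^ (rootMultiplicity c f - 1) ∣ derivative f :=
      pow_sub_one_dvd_derivative_of_pow_dvd (pow_rootMultiplicity_dvd f c)
    have := mul_dvd_mul h1 h2
    rwa [← pow_succ', Nat.sub_add_cancel h] at this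

theorem hb_natDegree_wronskian {F : Type*} [Field F] (g h : F[X])
    (hW : g * derivative h - derivative g * h ≠ 0) :
    (g * derivative h - derivative g * h).natDegree + 1 ≤ g.natDegree + h.natDegree := by
  have key : ∀ a b : F[X], a * derivative b ≠ 0 →
      (a * derivative b).natDegree + 1 ≤ a.natDegree + b.natDegree := by
    intro a b hab
    have hb : derivative b ≠ 0 := right_ne_zero_of_mul hab
    have hb' : b.natDegree ≠ 0 := by
      intro hb0
      rw [eq_C_of_natDegree_eq_zero hb0, derivative_C] at hb
      exact hb rfl
    have := natDegree_derivative_lt hb'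
    have h2 := natDegree_mul_le (p := a) (q := derivative b)
    omega
  have h1 := natDegree_sub_le (g * derivative h) (derivative g * h)
  by_cases ha : g * derivative h = 0
  · rw [ha, zero_sub, natDegree_neg]
    rw [ha, zero_sub, neg_ne_zero, mul_comm] at hW
    have := key _ _ hW
    rw [mul_comm (derivative g)]; omega
  · by_cases hb : derivative g * h = 0
    · rw [hb, sub_zero]; exact key _ _ ha
    · have e1 := key _ _ ha
      rw [mul_comm] at hb
      have e2 := key _ _ hb
      rw [mul_comm (derivative g)] at h1 ⊢
      rcases le_max_iff.1 h1 with h | h <;> omega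

theorem hb_reduce (q : ℕ) [Fact q.Prime] (i : ℕ)
    (ε : ℕ) (f g h : (ZMod q)[X]) (hfe : f = X ^ (q ^ (i + 1)) * g + h) (hs : f.Splits)
    (hg0 : g ≠ 0) (hg : g.natDegree ≤ ε) (hh : h.natDegree ≤ ε) (hε : ε < q ^ (i + 1)) :
    ∃ d f1 g1 h1 : (ZMod q)[X], f = d * f1 ∧ f1 = X ^ (q ^ (i + 1)) * g1 + h1 ∧ d ≠ 0 ∧
      g1 ≠ 0 ∧ f1 ≠ 0 ∧ f1.Splits ∧ IsCoprime g1 h1 ∧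
      d.natDegree + g1.natDegree ≤ ε ∧ d.natDegree + h1.natDegree ≤ ε ∧
      f.natDegree = d.natDegree + f1.natDegree ∧ f1.natDegree = q ^ (i + 1) + g1.natDegree ∧
      ((∃ a b, g1 = a ^ q ∧ h1 = b ^ q) ∨
       (g1 * derivative h1 - derivative g1 * h1 ≠ 0 ∧
        ∀ p : (ZMod q)[X], (∀ c, f1.eval c = 0 → p.eval c = 0) →
          f1 ∣ p * (g1 * derivative h1 - derivative g1 * h1))) := by
  classical
  have hq : q.Prime := Fact.out
  obtain ⟨d, hd⟩ : ∃ d, d = EuclideanDomain.gcd g h := ⟨_, rfl⟩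
  have hd0 : d ≠ 0 := by
    rw [hd]; intro h0
    exact hg0 (EuclideanDomain.gcd_eq_zero_iff.1 h0).1
  obtain ⟨g1, hg1⟩ : d ∣ g := hd ▸ EuclideanDomain.gcd_dvd_left g h
  obtain ⟨h1, hh1⟩ : d ∣ h := hd ▸ EuclideanDomain.gcd_dvd_right g h
  have hcop : IsCoprime g1 h1 := by
    obtain ⟨x, y, hxy⟩ : ∃ x y, d = g * x + h * y :=
      ⟨_, _, hd.trans (EuclideanDomain.gcd_eq_gcd_ab g h)⟩
    refine ⟨x, y, mul_left_cancel₀ hd0 ?_⟩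
    rw [mul_one]
    conv_rhs => rw [hxy, hg1, hh1]
    ring
  have hg10 : g1 ≠ 0 := by rintro rfl; simp at hg1; exact hg0 hg1
  have hdg : d.natDegree + g1.natDegree ≤ ε := by
    rwa [hg1, natDegree_mul hd0 hg10] at hg
  have hdh : d.natDegree + h1.natDegree ≤ ε := by
    by_cases h0 : h1 = 0
    · rw [h0, natDegree_zero]; omega
    · rwa [hh1, natDegree_mul hd0 h0] at hh
  obtain ⟨f1, hf1⟩ : ∃ f1, f1 = X ^ (q ^ (i + 1)) * g1 + h1 := ⟨_, rfl⟩
  have hff : f = d * f1 := by rw [hfe, hf1, hg1, hh1]; ring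
  have hmain : (X ^ (q ^ (i + 1)) * g1).natDegree = q ^ (i + 1) + g1.natDegree := by
    rw [natDegree_mul (pow_ne_zero _ X_ne_zero) hg10, natDegree_X_pow]
  have hdeg : f1.natDegree = q ^ (i + 1) + g1.natDegree := by
    rw [hf1, natDegree_add_eq_left_of_natDegree_lt, hmain]
    rw [hmain]; omega
  have hf10 : f1 ≠ 0 := by
    rintro h0
    rw [h0, natDegree_zero] at hdeg
    omega
  have hf0 : f ≠ 0 := by rw [hff]; exact mul_ne_zero hd0 hf10
  have hs1 : f1.Splits := hs.of_dvd hf0 (hff ▸ dvd_mul_left _ _)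
  refine ⟨d, f1, g1, h1, hff, hf1, hd0, hg10, hf10, hs1, hcop, hdg, hdh, ?_, hdeg, ?_⟩
  · rw [hff, natDegree_mul hd0 hf10]
  by_cases hW : g1 * derivative h1 - derivative g1 * h1 = 0
  · left
    have e1 : g1 * derivative h1 = derivative g1 * h1 := sub_eq_zero.1 hW
    have d1 : g1 ∣ derivative g1 := hcop.dvd_of_dvd_mul_right (e1 ▸ dvd_mul_right _ _)
    have d2 : h1 ∣ derivative h1 :=
      hcop.symm.dvd_of_dvd_mul_left (e1 ▸ dvd_mul_left _ _)
    rw [dvd_derivative_iff] at d1 d2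
    refine ⟨contract q g1, contract q h1, ?_, ?_⟩
    · rw [← ZMod.expand_card, expand_contract q d1 hq.ne_zero]
    · rw [← ZMod.expand_card, expand_contract q d2 hq.ne_zero]
  · right
    refine ⟨hW, fun p hp => ?_⟩
    have hdv1 := hb_dvd_mul_derivative f1 p hs1 hf10 hp
    have hder : derivative f1 = X ^ (q ^ (i + 1)) * derivative g1 + derivative h1 := by
      rw [hf1, derivative_add, derivative_mul, derivative_X_pow]
      simp
    have : p * (g1 * derivative h1 - derivative g1 * h1)
        = g1 * (p * derivative f1) - f1 * (p * derivative g1) := by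
      rw [hder, hf1]; ring
    rw [this]
    exact dvd_sub (hdv1.mul_left _) (dvd_mul_right _ _)

theorem hb_poly (q : ℕ) [Fact q.Prime] (hodd : Odd q) (i : ℕ) :
    ∀ (ε : ℕ) (f g h : (ZMod q)[X]), f = X ^ (q ^ (i + 1)) * g + h → f.Splits →
      g ≠ 0 → g.natDegree ≤ ε → h.natDegree ≤ ε → 2 * ε < q ^ i * (q + 1) →
      (∃ c, (X - C c) ^ (q ^ (i + 1)) ∣ f) ∨ f.natDegree + q ^ i ≤ q ^ (i + 1) + ε := by
  classical
  have hq : q.Prime := Fact.out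
  have hq3 : 3 ≤ q := by
    rcases hodd with ⟨m, hm⟩
    have := hq.two_le
    omega
  induction i with
  | zero =>
    intro ε f g h hfe hs hg0 hg hh hε
    have hεq : 2 * ε < q := by
      rcases hodd with ⟨m, hm⟩
      simp at hε; omega
    obtain ⟨d, f1, g1, h1, hff, hf1, hd0, hg10, hf10, hs1, hcop, hdg, hdh, hdf, hdeg, hW⟩ :=
      hb_reduce q 0 ε f g h hfe hs hg0 hg hh (by simp; omega)
    simp only [zero_add, pow_one, pow_zero] at *
    rcases hW with ⟨a, b, ha, hb⟩ | ⟨hW, hdv⟩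
    · left
      have hda : a.natDegree = 0 := by
        have : g1.natDegree = q * a.natDegree := by rw [ha, natDegree_pow]
        by_contra h0
        have : q * 1 ≤ q * a.natDegree := Nat.mul_le_mul_left _ (Nat.pos_of_ne_zero h0)
        omega
      have hdb : b.natDegree = 0 := by
        have : h1.natDegree = q * b.natDegree := by rw [hb, natDegree_pow]
        by_contra h0
        have : q * 1 ≤ q * b.natDegree := Nat.mul_le_mul_left _ (Nat.pos_of_ne_zero h0)
        omega
      obtain ⟨α, hα⟩ : ∃ α, a = C α := ⟨_, eq_C_of_natDegree_eq_zero hda⟩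
      obtain ⟨β, hβ⟩ : ∃ β, b = C β := ⟨_, eq_C_of_natDegree_eq_zero hdb⟩
      have hα0 : α ≠ 0 := by
        rintro rfl
        rw [hα, C_0, zero_pow hq.ne_zero] at ha
        exact hg10 ha
      refine ⟨-(β / α), ?_⟩
      have e : f1 = (X * a + b) ^ q := by
        rw [hf1, ha, hb, add_pow_char, mul_pow]
      have e2 : X * a + b = C α * (X - C (-(β / α))) := by
        rw [hα, hβ, C_neg, sub_neg_eq_add, mul_add, ← C_mul, mul_div_cancel₀ _ hα0, mul_comm]
      rw [hff, e, e2, mul_pow]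
      exact ((dvd_mul_left _ _)).mul_left _
    · by_cases hp : X * g1 + h1 = 0
      · right
        have hh1 : h1 = - (X * g1) := eq_neg_of_add_eq_zero_right hp
        have : h1.natDegree = g1.natDegree + 1 := by
          rw [hh1, natDegree_neg, natDegree_X_mul hg10]
        omega
      · exfalso
        have hdvd := hdv (X * g1 + h1) (by
          intro c hc
          rw [hf1] at hc
          simpa [ZMod.pow_card] using hc)
        have hle := natDegree_le_of_dvd hdvd (mul_ne_zero hp hW)
        rw [natDegree_mul hp hW] at hle
        have hw := hb_natDegree_wronskian g1 h1 hW
        have h2 := natDegree_add_le (X * g1) h1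
        rw [natDegree_X_mul hg10] at h2
        rcases le_max_iff.1 h2 with h | h <;> omega
  | succ i ih =>
    intro ε f g h hfe hs hg0 hg hh hε
    have hpos : 0 < q ^ i := pow_pos hq.pos _
    have hεq : ε + q ≤ q ^ (i + 1 + 1) := by
      have e1 : q ^ (i + 1 + 1) = q ^ i * q * q := by ring
      have e2 : q ^ (i + 1) = q ^ i * q := by ring
      rw [e1]; rw [e2] at hε
      generalize q ^ i = t at *
      nlinarith [Nat.mul_le_mul hpos (le_refl q), Nat.mul_le_mul (Nat.mul_le_mul hpos (le_refl q)) hq3]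
    obtain ⟨d, f1, g1, h1, hff, hf1, hd0, hg10, hf10, hs1, hcop, hdg, hdh, hdf, hdeg, hW⟩ :=
      hb_reduce q (i + 1) ε f g h hfe hs hg0 hg hh (by omega)
    rcases hW with ⟨a, b, ha, hb⟩ | ⟨hW, hdv⟩
    · have e : f1 = (X ^ (q ^ (i + 1)) * a + b) ^ q := by
        rw [hf1, ha, hb, add_pow_char, mul_pow, ← pow_mul, ← pow_succ]
      obtain ⟨f2, hf2⟩ : ∃ f2, f2 = X ^ (q ^ (i + 1)) * a + b := ⟨_, rfl⟩
      rw [← hf2] at e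
      have ha0 : a ≠ 0 := by
        rintro rfl
        rw [zero_pow hq.ne_zero] at ha
        exact hg10 ha
      have hga : g1.natDegree = q * a.natDegree := by rw [ha, natDegree_pow]
      have hhb : h1.natDegree = q * b.natDegree := by rw [hb, natDegree_pow]
      have hff2 : f1.natDegree = q * f2.natDegree := by rw [e, natDegree_pow]
      have hs2 : f2.Splits := hs1.of_dvd hf10 (e ▸ dvd_pow_self _ hq.ne_zero)
      have hmax : q * max a.natDegree b.natDegree + d.natDegree ≤ ε := by
        rcases max_choice a.natDegree b.natDegree with h | h <;> rw [h] <;> omega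
      rcases ih (max a.natDegree b.natDegree) f2 a b hf2 hs2 ha0 (le_max_left _ _)
        (le_max_right _ _) (by
          have h1 : q * (2 * max a.natDegree b.natDegree) < q * (q ^ i * (q + 1)) := by
            calc _ = 2 * (q * max a.natDegree b.natDegree) := by ring
              _ < q ^ (i + 1) * (q + 1) := by omega
              _ = _ := by ring
          exact lt_of_mul_lt_mul_left h1 (Nat.zero_le _)) with ⟨c, hc⟩ | hc
      · left
        refine ⟨c, ?_⟩
        rw [hff, e, pow_succ q (i + 1), pow_mul]
        exact (pow_dvd_pow_of_dvd hc q).mul_left _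
      · right
        have := Nat.mul_le_mul_left q hc
        rw [mul_add, mul_add, ← hff2, ← pow_succ', ← pow_succ'] at this
        omega
    · exfalso
      have hX : (X ^ q - X : (ZMod q)[X]) ≠ 0 := FiniteField.X_pow_card_sub_X_ne_zero _ hq.one_lt
      have hdvd := hdv (X ^ q - X) (by intro c hc; simp [ZMod.pow_card])
      have hle := natDegree_le_of_dvd hdvd (mul_ne_zero hX hW)
      rw [natDegree_mul hX hW, FiniteField.X_pow_card_sub_X_natDegree_eq _ hq.one_lt] at hle
      have hw := hb_natDegree_wronskian g1 h1 hW
      omega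
end Poly

section Coeff

theorem hb_natDegree_lin {L ι : Type*} [Field L] (U : Finset ι) (a b : ι → L) :
    (∏ u ∈ U, (Polynomial.C (a u) * Polynomial.X + Polynomial.C (b u))).natDegree ≤ U.card := by
  refine (Polynomial.natDegree_prod_le _ _).trans ?_
  refine (Finset.sum_le_sum (fun u _ => Polynomial.natDegree_linear_le)).trans ?_
  simp

theorem hb_coeff {L ι : Type*} [Field L] (U : Finset ι) (a b p : ι → L) :
    ∀ t : Fin 2 →₀ ℕ, U.card ≤ t 0 + t 1 →
      MvPolynomial.coeff t (∏ u ∈ U, (MvPolynomial.C (a u) * MvPolynomial.X 0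
        + MvPolynomial.C (b u) * MvPolynomial.X 1 - MvPolynomial.C (p u))) =
      if t 0 + t 1 = U.card then
        (∏ u ∈ U, (Polynomial.C (a u) * Polynomial.X + Polynomial.C (b u))).coeff (t 0)
      else 0 := by
  classical
  induction U using Finset.induction_on with
  | empty =>
    intro t _
    simp only [Finset.prod_empty, Finset.card_empty, MvPolynomial.coeff_one, Polynomial.coeff_one]
    by_cases h : t 0 + t 1 = 0
    · have : t = 0 := by
        ext i; fin_cases i <;> simp <;> omega
      simp [this]
    · rw [if_neg h, if_neg]
      rintro rfl
      simp at h
  | insert v U hv ih =>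
    intro t ht
    rw [Finset.card_insert_of_notMem hv] at ht ⊢
    rw [Finset.prod_insert hv, Finset.prod_insert hv]
    set R := ∏ u ∈ U, (MvPolynomial.C (a u) * MvPolynomial.X (0 : Fin 2)
        + MvPolynomial.C (b u) * MvPolynomial.X 1 - MvPolynomial.C (p u)) with hR
    set f := ∏ u ∈ U, (Polynomial.C (a u) * Polynomial.X + Polynomial.C (b u)) with hf
    have hfd : f.natDegree ≤ U.card := hb_natDegree_lin U a b
    have h3 : MvPolynomial.coeff t R = 0 := by
      rw [ih t (by omega), if_neg (by omega)]
    have e1 : (MvPolynomial.C (a v) * MvPolynomial.X 0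
        + MvPolynomial.C (b v) * MvPolynomial.X 1 - MvPolynomial.C (p v)) * R =
        MvPolynomial.C (a v) * (MvPolynomial.X 0 * R) + MvPolynomial.C (b v) *
          (MvPolynomial.X 1 * R) - MvPolynomial.C (p v) * R := by ring
    have e2 : (Polynomial.C (a v) * Polynomial.X + Polynomial.C (b v)) * f =
      Polynomial.C (a v) * (Polynomial.X * f) + Polynomial.C (b v) * f := by ring
    rw [e1, e2, MvPolynomial.coeff_sub, MvPolynomial.coeff_add, MvPolynomial.coeff_C_mul,
      MvPolynomial.coeff_C_mul, MvPolynomial.coeff_C_mul, h3, MvPolynomial.coeff_X_mul',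
      MvPolynomial.coeff_X_mul', Polynomial.coeff_add, Polynomial.coeff_C_mul,
      Polynomial.coeff_C_mul]
    have g0 : (if (0 : Fin 2) ∈ t.support then
        MvPolynomial.coeff (t - Finsupp.single 0 1) R else 0) =
        if t 0 + t 1 = U.card + 1 then (Polynomial.X * f).coeff (t 0) else 0 := by
      by_cases h : t 0 = 0
      · simp [h]
      · rw [if_pos (by simpa using h)]
        have z0 : (t - Finsupp.single 0 1 : Fin 2 →₀ ℕ) 0 = t 0 - 1 := by simp
        have z1 : (t - Finsupp.single 0 1 : Fin 2 →₀ ℕ) 1 = t 1 := by simp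
        rw [ih _ (by rw [z0, z1]; omega), z0, z1]
        obtain ⟨m, hm⟩ := Nat.exists_eq_succ_of_ne_zero h
        rw [hm, Nat.succ_eq_add_one, Polynomial.coeff_X_mul]
        simp only [Nat.add_sub_cancel]
        by_cases h' : m + t 1 = U.card
        · rw [if_pos h', if_pos (by omega)]
        · rw [if_neg h', if_neg (by omega)]
    have g1 : (if (1 : Fin 2) ∈ t.support then
        MvPolynomial.coeff (t - Finsupp.single 1 1) R else 0) =
        if t 0 + t 1 = U.card + 1 then f.coeff (t 0) else 0 := by
      by_cases h : t 1 = 0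
      · rw [if_neg (by simpa using h)]
        split_ifs with h'
        · rw [Polynomial.coeff_eq_zero_of_natDegree_lt (by omega)]
        · rfl
      · rw [if_pos (by simpa using h)]
        have z0 : (t - Finsupp.single 1 1 : Fin 2 →₀ ℕ) 0 = t 0 := by simp
        have z1 : (t - Finsupp.single 1 1 : Fin 2 →₀ ℕ) 1 = t 1 - 1 := by simp
        rw [ih _ (by rw [z0, z1]; omega), z0, z1]
        by_cases h' : t 0 + (t 1 - 1) = U.card
        · rw [if_pos h', if_pos (by omega)]
        · rw [if_neg h', if_neg (by omega)]
    rw [g0, g1]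
    split_ifs <;> simp

theorem hb_coeff_zero {L ι : Type*} [Field L] [Finite L] (U : Finset ι) (a b p : ι → L)
    (hU : ∀ x y : L, ∃ u ∈ U, a u * x + b u * y = p u) (j : ℕ) (hj : j ≤ U.card)
    (h1 : j < Nat.card L) (h2 : U.card - j < Nat.card L) :
    (∏ u ∈ U, (Polynomial.C (a u) * Polynomial.X + Polynomial.C (b u))).coeff j = 0 := by
  classical
  have := Fintype.ofFinite L
  by_contra hne
  set R := ∏ u ∈ U, (MvPolynomial.C (a u) * MvPolynomial.X (0 : Fin 2)
        + MvPolynomial.C (b u) * MvPolynomial.X 1 - MvPolynomial.C (p u)) with hR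
  let t : Fin 2 →₀ ℕ := Finsupp.equivFunOnFinite.symm ![j, U.card - j]
  have t0 : t 0 = j := by simp [t]
  have t1 : t 1 = U.card - j := by simp [t]
  have hc : MvPolynomial.coeff t R ≠ 0 := by
    rw [hR, hb_coeff U a b p t (by rw [t0, t1]; omega), if_pos (by rw [t0, t1]; omega), t0]
    exact hne
  have hdt : Finsupp.degree t = U.card := by
    rw [Finsupp.degree_eq_sum, Fin.sum_univ_two, t0, t1]; omega
  have htd : R.totalDegree = Finsupp.degree t := by
    apply le_antisymm
    · rw [hdt, hR]
      refine (MvPolynomial.totalDegree_finsetProd _ _).trans ?_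
      refine (Finset.sum_le_card_nsmul _ _ 1 ?_).trans (by simp)
      intro u _
      refine (MvPolynomial.totalDegree_sub _ _).trans (max_le ?_ (by simp))
      refine (MvPolynomial.totalDegree_add _ _).trans (max_le ?_ ?_) <;>
      · refine (MvPolynomial.totalDegree_mul _ _).trans ?_
        simp
    · exact MvPolynomial.le_totalDegree (by simpa [MvPolynomial.mem_support_iff] using hc)
  obtain ⟨s, hs, hev⟩ := MvPolynomial.combinatorial_nullstellensatz_exists_eval_nonzero R t hc htd
    (fun _ => Finset.univ) (by
      intro i
      rw [Finset.card_univ, ← Nat.card_eq_fintype_card]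
      fin_cases i
      · simpa [t0] using h1
      · simpa [t1] using h2)
  apply hev
  obtain ⟨u, hu, he⟩ := hU (s 0) (s 1)
  rw [hR, map_prod]
  apply Finset.prod_eq_zero hu
  simp [he]

end Coeff

section PolyApply
open Polynomial

theorem hb_poly_apply (q : ℕ) [Fact q.Prime] (hodd : Odd q) (i : ℕ) {V L : Type*}
    [Field L] [Finite L] [Algebra (ZMod q) L] (hL : Nat.card L = q ^ (i + 1))
    (U Z : Finset V) (y : V → ZMod q) (p : V → L)
    (hU : ∀ x z : L, (∃ u ∈ U, x + algebraMap (ZMod q) L (y u) * z = p u) ∨ ∃ u ∈ Z, z = p u)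
    (hZ : Z.card < q ^ i) (hN : 2 * (U.card + Z.card) < q ^ i * (3 * q + 1)) :
    ∃ c, q ^ (i + 1) ≤ (U.filter (fun u => y u = c)).card := by
  classical
  have hq : q.Prime := Fact.out
  set Q := q ^ (i + 1) with hQ
  have hqi : q ^ i ≤ Q := Nat.pow_le_pow_right hq.pos (Nat.le_succ i)
  set f : (ZMod q)[X] := ∏ u ∈ U, (X - C (- y u)) with hf
  have hmon : f.Monic := monic_prod_X_sub_C _ _
  have hdeg : f.natDegree = U.card := by
    rw [hf, natDegree_prod_of_monic _ _ (fun u _ => monic_X_sub_C _)]; simp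
  have hcoef : ∀ j, j ≤ U.card + Z.card → j < Q → U.card + Z.card - j < Q → f.coeff j = 0 := by
    intro j h1 h2 h3
    have := hb_coeff_zero (L := L) (U.disjSum Z)
      (Sum.elim (fun _ => 1) (fun _ => 0)) (Sum.elim (fun u => algebraMap (ZMod q) L (y u))
        (fun _ => 1)) (Sum.elim p p) (by
          intro x z
          rcases hU x z with ⟨u, hu, h⟩ | ⟨u, hu, h⟩
          · exact ⟨Sum.inl u, by simpa using hu, by simpa using h⟩
          · exact ⟨Sum.inr u, by simpa using hu, by simpa using h⟩) j
      (by simpa using h1) (by rw [hL]; exact h2) (by rw [hL]; simpa using h3)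
    rw [Finset.prod_disjSum] at this
    simp only [Sum.elim_inl, Sum.elim_inr, map_one, map_zero, one_mul, zero_mul, zero_add,
      Finset.prod_const_one, mul_one] at this
    have e : f.map (algebraMap (ZMod q) L) = ∏ u ∈ U, (X + C (algebraMap (ZMod q) L (y u))) := by
      rw [hf, Polynomial.map_prod]
      simp
    rw [← e, coeff_map] at this
    exact (map_eq_zero _).1 this
  have hUQ : Q ≤ U.card := by
    by_contra hlt
    have := hcoef U.card (by omega) (by omega) (by omega)
    rw [← hdeg, hmon.coeff_natDegree] at this
    exact one_ne_zero this
  have hmQ : (X ^ Q : (ZMod q)[X]).Monic := monic_X_pow Q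
  have hdecomp : f = X ^ Q * (f /ₘ X ^ Q) + f %ₘ X ^ Q := by
    rw [add_comm]; exact (modByMonic_add_div f _).symm
  have hgd : (f /ₘ X ^ Q).natDegree = U.card - Q := by
    rw [natDegree_divByMonic f hmQ, hdeg, natDegree_X_pow]
  have hg0 : f /ₘ X ^ Q ≠ 0 := by
    rw [Ne, divByMonic_eq_zero_iff hmQ, not_lt]
    rw [degree_eq_natDegree hmon.ne_zero, hdeg, degree_X_pow]
    exact_mod_cast hUQ
  have hhd : (f %ₘ X ^ Q).natDegree ≤ U.card + Z.card - Q := by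
    rw [natDegree_le_iff_coeff_eq_zero]
    intro j hj
    by_cases hjQ : j < Q
    · have h1 := congrArg (fun r => r.coeff j) hdecomp
      simp only [coeff_add, coeff_X_pow_mul'] at h1
      rw [if_neg (by omega), zero_add] at h1
      rw [← h1]
      exact hcoef j (by omega) hjQ (by omega)
    · apply coeff_eq_zero_of_degree_lt
      refine (degree_modByMonic_lt f hmQ).trans_le ?_
      rw [degree_X_pow]
      exact_mod_cast (not_lt.1 hjQ)
  have hsplit : f.Splits := by
    rw [hf]
    exact Splits.prod (fun u _ => Splits.X_sub_C _)
  have hQe : Q = q ^ i * q := by rw [hQ, pow_succ]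
  have hε : 2 * (U.card + Z.card - Q) < q ^ i * (q + 1) := by
    have : q ^ i * (3 * q + 1) = q ^ i * (q + 1) + 2 * Q := by rw [hQe]; ring
    omega
  rcases hb_poly q hodd i (U.card + Z.card - Q) f _ _ hdecomp hsplit hg0
    (by rw [hgd]; omega) hhd hε with ⟨c, hc⟩ | hc
  · refine ⟨-c, ?_⟩
    have h1 := (le_rootMultiplicity_iff hmon.ne_zero).2 hc
    rw [← count_roots] at h1
    have h2 : f.roots = U.val.map (fun u => - y u) := by
      have := roots_multiset_prod_X_sub_C (U.val.map (fun u => - y u))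
      rw [Multiset.map_map] at this
      exact this
    rw [h2, Multiset.count_map] at h1
    refine h1.trans (le_of_eq ?_)
    rw [Finset.card_def, Finset.filter_val]
    congr 1
    apply Multiset.filter_congr
    intro u _
    constructor
    · intro h; rw [h, neg_neg]
    · intro h; rw [h, neg_neg]
  · rw [hdeg] at hc
    omega

end PolyApply

section Cones
open Module

/-- A set of nonzero vectors closed under multiplication by nonzero scalars. -/
structure HBCone (q : ℕ) {V : Type*} [AddCommGroup V] [Module (ZMod q) V] (S : Set V) : Prop where
  zero : (0 : V) ∉ S
  smul : ∀ (c : ZMod q) (v : V), c ≠ 0 → v ∈ S → c • v ∈ S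

/-- Every subspace of codimension at most `k` meets `S`. -/
def HBBlk (q k : ℕ) {V : Type*} [AddCommGroup V] [Module (ZMod q) V] (S : Set V) : Prop :=
  ∀ W : Submodule (ZMod q) V, finrank (ZMod q) V ≤ finrank (ZMod q) W + k → ∃ v ∈ W, v ∈ S

theorem hb_card_units (q : ℕ) [Fact q.Prime] : ({0}ᶜ : Set (ZMod q)).ncard = q - 1 := by
  rw [Set.ncard_compl, Set.ncard_singleton, Nat.card_zmod]

theorem hb_cone_card (q : ℕ) [Fact q.Prime] {V : Type*} [AddCommGroup V] [Module (ZMod q) V]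
    [Finite V] (T : Set V) (hT : ∀ (c : ZMod q) (v : V), c ≠ 0 → v ∈ T → c • v ∈ T)
    (φ : V →ₗ[ZMod q] ZMod q) :
    (q - 1) * {v | v ∈ T ∧ φ v = 1}.ncard ≤ {v | v ∈ T ∧ φ v ≠ 0}.ncard := by
  rw [← hb_card_units q, ← Set.ncard_prod]
  have hinj : Set.InjOn (fun x : ZMod q × V => x.1 • x.2)
      (({0}ᶜ : Set (ZMod q)) ×ˢ {v | v ∈ T ∧ φ v = 1}) := by
    rintro ⟨c, u⟩ ⟨hc, -, hu⟩ ⟨c', u'⟩ ⟨hc', -, hu'⟩ h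
    simp only at h hu hu' hc hc'
    have h1 := congrArg φ h
    rw [map_smul, map_smul, hu, hu', smul_eq_mul, smul_eq_mul, mul_one, mul_one] at h1
    subst h1
    rw [smul_right_injective V (by simpa using hc) h]
  rw [← Set.InjOn.ncard_image hinj]
  apply Set.ncard_le_ncard _ (Set.toFinite _)
  rintro _ ⟨⟨c, u⟩, ⟨hc, hu1, hu⟩, rfl⟩
  simp only at hu hc hu1
  refine ⟨hT _ _ (by simpa using hc) hu1, ?_⟩
  simp only [map_smul, hu, smul_eq_mul, mul_one]
  simpa using hc

theorem hb_T_base (q : ℕ) [Fact q.Prime] (hodd : Odd q) (i : ℕ) {V : Type*} [AddCommGroup V]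
    [Module (ZMod q) V] [Finite V] (hV : finrank (ZMod q) V = i + 3) (S : Set V)
    (hS : HBCone q S) (hB : HBBlk q (i + 1) S) (K : Submodule (ZMod q) V)
    (hK : finrank (ZMod q) K = i + 1) (hKS : ∀ v ∈ K, v ≠ 0 → v ∈ S)
    (y1 : V →ₗ[ZMod q] ZMod q) (hy1 : y1 ≠ 0) (hKy : K ≤ LinearMap.ker y1)
    (hlight : {v | v ∈ S ∧ y1 v = 0 ∧ v ∉ K}.ncard < (q - 1) * q ^ i)
    (hcard : 2 * {v | v ∈ S ∧ v ∉ K}.ncard < (q - 1) * q ^ i * (3 * q + 1)) :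
    ∃ D : Submodule (ZMod q) V, K ≤ D ∧ finrank (ZMod q) D = i + 2 ∧
      ∀ v ∈ D, v ≠ 0 → v ∈ S := by
  classical
  have hq : q.Prime := Fact.out
  have hq1 : 0 < q - 1 := by have := hq.two_le; omega
  have hker1 : finrank (ZMod q) (LinearMap.ker y1) + 1 = i + 3 := by
    rw [← hV]; exact Module.Dual.finrank_ker_add_one_of_ne_zero hy1
  have hlt : K < LinearMap.ker y1 := by
    refine lt_of_le_of_ne hKy ?_
    intro h
    rw [← h, hK] at hker1
    omega
  obtain ⟨w, hw1, hwK⟩ := SetLike.exists_of_lt hlt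
  obtain ⟨g, hgw, hKg⟩ := Submodule.exists_le_ker_of_notMem hwK
  obtain ⟨y2, hy2w, hKy2⟩ : ∃ y2 : V →ₗ[ZMod q] ZMod q, y2 w = 1 ∧ K ≤ LinearMap.ker y2 := by
    refine ⟨(g w)⁻¹ • g, by simp [hgw], ?_⟩
    intro v hv
    have := hKg hv
    rw [LinearMap.mem_ker] at this ⊢
    simp [this]
  have hw1' : y1 w = 0 := hw1
  have hinf : ∀ v, y1 v = 0 → y2 v = 0 → v ∈ K := by
    have hle : K ≤ LinearMap.ker y1 ⊓ LinearMap.ker y2 := le_inf hKy hKy2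
    have hlt2 : LinearMap.ker y1 ⊓ LinearMap.ker y2 < LinearMap.ker y1 := by
      refine lt_of_le_of_ne inf_le_left ?_
      intro h
      have : w ∈ LinearMap.ker y1 ⊓ LinearMap.ker y2 := by rw [h]; exact hw1
      have := this.2
      rw [SetLike.mem_coe, LinearMap.mem_ker, hy2w] at this
      exact one_ne_zero this
    have := Submodule.finrank_lt_finrank_of_lt hlt2
    have heq := Submodule.eq_of_le_of_finrank_le hle (by omega)
    intro v h1 h2
    rw [heq]
    exact ⟨h1, h2⟩
  have hk1 : ∀ v ∈ K, y1 v = 0 := fun v hv => hKy hv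
  have hk2 : ∀ v ∈ K, y2 v = 0 := fun v hv => hKy2 hv
  let L := GaloisField q (i + 1)
  have hLf : finrank (ZMod q) L = i + 1 := GaloisField.finrank q (Nat.succ_ne_zero i)
  have hLc : Nat.card L = q ^ (i + 1) := GaloisField.card q (i + 1) (Nat.succ_ne_zero i)
  have e : K ≃ₗ[ZMod q] L := LinearEquiv.ofFinrankEq _ _ (by rw [hK, hLf])
  obtain ⟨π, hπ⟩ := LinearMap.exists_extend (e : K →ₗ[ZMod q] L)
  have hπK : ∀ v ∈ K, π v = 0 → v = 0 := by
    intro v hv h0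
    have := congrArg (fun r => r ⟨v, hv⟩) hπ
    simp only [LinearMap.comp_apply, Submodule.subtype_apply] at this
    rw [h0] at this
    have h2 : e ⟨v, hv⟩ = 0 := this.symm
    rw [LinearEquiv.map_eq_zero_iff] at h2
    exact congrArg Subtype.val h2
  set A1 : Set V := {v | v ∈ S ∧ y1 v = 1} with hA1
  set A2 : Set V := {v | (v ∈ S ∧ y1 v = 0) ∧ y2 v = 1} with hA2
  have f1 := Set.toFinite A1
  have f2 := Set.toFinite A2
  have c1 : (q - 1) * A1.ncard ≤ {v | v ∈ S ∧ y1 v ≠ 0}.ncard :=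
    hb_cone_card q S hS.smul y1
  have c2 : (q - 1) * A2.ncard ≤ {v | (v ∈ S ∧ y1 v = 0) ∧ y2 v ≠ 0}.ncard :=
    hb_cone_card q {v | v ∈ S ∧ y1 v = 0} (by
      rintro c v hc ⟨hv, h0⟩
      exact ⟨hS.smul c v hc hv, by simp [h0]⟩) y2
  have c3 : {v | (v ∈ S ∧ y1 v = 0) ∧ y2 v ≠ 0}.ncard ≤ {v | v ∈ S ∧ y1 v = 0 ∧ v ∉ K}.ncard := by
    apply Set.ncard_le_ncard _ (Set.toFinite _)
    rintro v ⟨⟨h1, h2⟩, h3⟩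
    exact ⟨h1, h2, fun h => h3 (hk2 v h)⟩
  have c4 : {v | v ∈ S ∧ y1 v ≠ 0}.ncard + {v | v ∈ S ∧ y1 v = 0 ∧ v ∉ K}.ncard
      ≤ {v | v ∈ S ∧ v ∉ K}.ncard := by
    rw [← Set.ncard_union_eq _ (Set.toFinite _) (Set.toFinite _)]
    · apply Set.ncard_le_ncard _ (Set.toFinite _)
      rintro v (⟨h1, h2⟩ | ⟨h1, h2, h3⟩)
      · exact ⟨h1, fun h => h2 (hk1 v h)⟩
      · exact ⟨h1, h3⟩
    · rw [Set.disjoint_left]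
      rintro v ⟨_, h2⟩ ⟨_, h3, _⟩
      exact h2 h3
  have hZ : A2.ncard < q ^ i := by
    have : (q - 1) * A2.ncard < (q - 1) * q ^ i := by omega
    exact lt_of_mul_lt_mul_left this (Nat.zero_le _)
  have hN : 2 * (A1.ncard + A2.ncard) < q ^ i * (3 * q + 1) := by
    have : (q - 1) * (2 * (A1.ncard + A2.ncard)) < (q - 1) * (q ^ i * (3 * q + 1)) := by
      calc _ = 2 * ((q - 1) * A1.ncard + (q - 1) * A2.ncard) := by ring
        _ ≤ 2 * {v | v ∈ S ∧ v ∉ K}.ncard := by omega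
        _ < _ := hcard
        _ = _ := by ring
    exact lt_of_mul_lt_mul_left this (Nat.zero_le _)
  obtain ⟨c, hc⟩ := hb_poly_apply q hodd i (L := L) hLc f1.toFinset f2.toFinset
    (fun v => y2 v) (fun v => π v) (by
      intro x z
      let M : V →ₗ[ZMod q] L := y1.smulRight x + y2.smulRight z - π
      have hM : finrank (ZMod q) V ≤ finrank (ZMod q) (LinearMap.ker M) + (i + 1) := by
        have h1 := LinearMap.finrank_range_add_finrank_ker M
        have h2 := Submodule.finrank_le (LinearMap.range M)
        omega
      obtain ⟨v, hvM, hvS⟩ := hB _ hM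
      have hv : y1 v • x + y2 v • z = π v := by
        rw [LinearMap.mem_ker] at hvM
        exact sub_eq_zero.1 hvM
      by_cases h1 : y1 v = 0
      · right
        have h2 : y2 v ≠ 0 := by
          intro h2
          rw [h1, h2, zero_smul, zero_smul, zero_add] at hv
          have := hπK v (hinf v h1 h2) hv.symm
          exact hS.zero (this ▸ hvS)
        refine ⟨(y2 v)⁻¹ • v, ?_, ?_⟩
        · rw [Set.Finite.mem_toFinset]
          exact ⟨⟨hS.smul _ _ (inv_ne_zero h2) hvS, by simp [h1]⟩, by simp [h2]⟩
        · rw [map_smul, ← hv, h1, zero_smul, zero_add, smul_smul, inv_mul_cancel₀ h2, one_smul]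
      · left
        refine ⟨(y1 v)⁻¹ • v, ?_, ?_⟩
        · rw [Set.Finite.mem_toFinset]
          exact ⟨hS.smul _ _ (inv_ne_zero h1) hvS, by simp [h1]⟩
        · rw [← Algebra.smul_def, LinearMap.map_smul π, LinearMap.map_smul y2, ← hv, smul_add,
            smul_smul, smul_smul, inv_mul_cancel₀ h1, one_smul, smul_eq_mul])
    (by rw [← Set.ncard_eq_toFinset_card A2 f2]; exact hZ)
    (by rw [← Set.ncard_eq_toFinset_card A1 f1, ← Set.ncard_eq_toFinset_card A2 f2]; exact hN)
  have hcoset : ∀ v, y1 v = 1 → y2 v = c → v ∈ S := by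
    set W : Set V := {v | y1 v = 1 ∧ y2 v = c} with hW
    have hpos : 0 < q ^ (i + 1) := pow_pos hq.pos _
    obtain ⟨v0, hv0⟩ := Finset.card_pos.1 (hpos.trans_le hc)
    rw [Finset.mem_filter, Set.Finite.mem_toFinset] at hv0
    have hWc : W.ncard ≤ q ^ (i + 1) := by
      have hKc : (K : Set V).ncard = q ^ (i + 1) := by
        have := Module.natCard_eq_pow_finrank (K := ZMod q) (V := K)
        rw [hK, Nat.card_zmod] at this
        exact this
      rw [← hKc]
      apply Set.ncard_le_ncard_of_injOn (fun v => v - v0) _ _ (Set.toFinite _)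
      · rintro v ⟨h1, h2⟩
        apply hinf
        · rw [map_sub, h1, hv0.1.2, sub_self]
        · rw [map_sub, h2, hv0.2, sub_self]
      · intro a _ b _ h
        simpa using h
    have heq := Set.eq_of_subset_of_ncard_le
      (s := ((f1.toFinset.filter (fun u => y2 u = c) : Finset V) : Set V)) (t := W) (by
        intro v hv
        rw [Finset.mem_coe, Finset.mem_filter, Set.Finite.mem_toFinset] at hv
        exact ⟨hv.1.2, hv.2⟩) (by rw [Set.ncard_coe_finset]; omega) (Set.toFinite _)
    intro v h1 h2
    have : v ∈ W := ⟨h1, h2⟩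
    rw [← heq, Finset.mem_coe, Finset.mem_filter, Set.Finite.mem_toFinset] at this
    exact this.1.1
  have hne : y2 - c • y1 ≠ 0 := by
    intro h
    have := congrArg (fun r => r w) h
    simp [hy2w, hw1'] at this
  refine ⟨LinearMap.ker (y2 - c • y1), ?_, ?_, ?_⟩
  · intro v hv
    simp [hk1 v hv, hk2 v hv]
  · have := Module.Dual.finrank_ker_add_one_of_ne_zero hne
    omega
  · intro v hv hv0
    have hv' : y2 v = c * y1 v := by
      rw [LinearMap.mem_ker] at hv
      exact sub_eq_zero.1 hv
    by_cases h1 : y1 v = 0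
    · exact hKS v (hinf v h1 (by rw [hv', h1, mul_zero])) hv0
    · have := hcoset ((y1 v)⁻¹ • v) (by simp [h1]) (by
        rw [map_smul, hv', smul_eq_mul]; field_simp)
      have h2 := hS.smul (y1 v) _ h1 this
      rwa [smul_smul, mul_inv_cancel₀ h1, one_smul] at h2

end Cones

section Main
open Module


theorem hb_ncard (q : ℕ) [Fact q.Prime] {V : Type*} [AddCommGroup V] [Module (ZMod q) V]
    [Finite V] (K : Submodule (ZMod q) V) : (K : Set V).ncard = q ^ finrank (ZMod q) K := by
  have := Module.natCard_eq_pow_finrank (K := ZMod q) (V := K)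
  rw [Nat.card_zmod] at this
  exact this

theorem hb_avg (q : ℕ) [Fact q.Prime] {V : Type*} [AddCommGroup V] [Module (ZMod q) V]
    [Finite V] (D : Submodule (ZMod q) V) (v : V) (hv : v ∉ D) (T : Set V)
    (hT : ∀ t ∈ T, t ∉ D ⊔ Submodule.span (ZMod q) {v}) :
    ∃ f : V →ₗ[ZMod q] ZMod q, D ≤ LinearMap.ker f ∧ f v = 1 ∧
      q * {t | t ∈ T ∧ f t = 0}.ncard ≤ T.ncard := by
  classical
  have hq : q.Prime := Fact.out
  have : Finite (V →ₗ[ZMod q] ZMod q) := DFunLike.finite _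
  have := Fintype.ofFinite (V →ₗ[ZMod q] ZMod q)
  have := Fintype.ofFinite V
  set Φ : Finset (V →ₗ[ZMod q] ZMod q) :=
    Finset.univ.filter (fun f => D ≤ LinearMap.ker f ∧ f v = 1) with hΦ
  have hne : Φ.Nonempty := by
    obtain ⟨g, hg, hDg⟩ := Submodule.exists_le_ker_of_notMem hv
    refine ⟨(g v)⁻¹ • g, ?_⟩
    rw [hΦ, Finset.mem_filter]
    refine ⟨Finset.mem_univ _, ?_, by simp [hg]⟩
    intro x hx
    have := hDg hx
    rw [LinearMap.mem_ker] at this ⊢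
    simp [this]
  set TF : Finset V := Finset.univ.filter (fun t => t ∈ T) with hTF
  have hTc : T.ncard = TF.card := by
    rw [← Set.ncard_coe_finset]; congr 1; ext x; simp [hTF]
  have hTf : ∀ f : V →ₗ[ZMod q] ZMod q, {t | t ∈ T ∧ f t = 0}.ncard =
      (TF.filter (fun t => f t = 0)).card := by
    intro f
    rw [← Set.ncard_coe_finset]; congr 1; ext x; simp [hTF]
  by_contra hcon
  push Not at hcon
  have key : ∀ t ∈ TF, q * (Φ.filter (fun f => f t = 0)).card ≤ Φ.card := by
    intro t ht
    rw [hTF, Finset.mem_filter] at ht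
    obtain ⟨g, hg, hDg⟩ := Submodule.exists_le_ker_of_notMem (hT t ht.2)
    have hgD : D ≤ LinearMap.ker g := le_sup_left.trans hDg
    have hgv : g v = 0 := hDg ((le_sup_right : _ ≤ D ⊔ Submodule.span (ZMod q) {v})
      (Submodule.mem_span_singleton_self v))
    have hcq : (Finset.univ : Finset (ZMod q)).card = q := by
      rw [Finset.card_univ, ZMod.card]
    calc q * (Φ.filter (fun f => f t = 0)).card
        = ((Finset.univ : Finset (ZMod q)) ×ˢ (Φ.filter (fun f => f t = 0))).card := by
          rw [Finset.card_product, hcq]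
      _ ≤ Φ.card := by
          apply Finset.card_le_card_of_injOn (fun x => x.2 + x.1 • g)
          · rintro ⟨c, f⟩ hcf
            simp only [Finset.coe_product, Set.mem_prod, Finset.mem_coe, Finset.mem_filter, hΦ,
              Finset.mem_univ, true_and] at hcf ⊢
            refine ⟨?_, by simp [hcf.1.2, hgv]⟩
            intro x hx
            have h1 := hcf.1.1 hx
            have h2 := hgD hx
            rw [LinearMap.mem_ker] at h1 h2 ⊢
            simp [h1, h2]
          · rintro ⟨c, f⟩ hcf ⟨c', f'⟩ hcf' h
            simp only [Finset.coe_product, Set.mem_prod, Finset.mem_coe, Finset.mem_filter]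
              at hcf hcf'
            simp only at h
            have h1 := congrArg (fun r => r t) h
            simp only [LinearMap.add_apply, LinearMap.smul_apply, hcf.2.2, hcf'.2.2, zero_add,
              smul_eq_mul] at h1
            have h2 := mul_right_cancel₀ hg h1
            subst h2
            rw [add_right_cancel h]
  have h1 : ∑ f ∈ Φ, TF.card < ∑ f ∈ Φ, q * (TF.filter (fun t => f t = 0)).card := by
    apply Finset.sum_lt_sum_of_nonempty hne
    intro f hf
    rw [hΦ, Finset.mem_filter] at hf
    have := hcon f hf.2.1 hf.2.2
    rwa [hTc, hTf] at this
  have h2 : ∑ f ∈ Φ, q * (TF.filter (fun t => f t = 0)).card =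
      ∑ t ∈ TF, q * (Φ.filter (fun f => f t = 0)).card := by
    rw [← Finset.mul_sum, ← Finset.mul_sum]
    congr 1
    simp only [Finset.card_filter]
    exact Finset.sum_comm
  have h3 : ∑ t ∈ TF, q * (Φ.filter (fun f => f t = 0)).card ≤ ∑ t ∈ TF, Φ.card :=
    Finset.sum_le_sum key
  rw [h2] at h1
  have h4 := h1.trans_le h3
  simp only [Finset.sum_const, smul_eq_mul] at h4
  rw [mul_comm] at h4
  exact lt_irrefl _ h4

theorem hb_diff (q : ℕ) [Fact q.Prime] {V : Type*} [AddCommGroup V] [Module (ZMod q) V]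
    [Finite V] (A E : Submodule (ZMod q) V) (a : ℕ) (hA : finrank (ZMod q) A = a + 1)
    (h : ¬ A ≤ E) : (q - 1) * q ^ a ≤ {v | v ∈ A ∧ v ∉ E}.ncard := by
  have hq : q.Prime := Fact.out
  have hlt : A ⊓ E < A := lt_of_le_of_ne inf_le_left (fun h' => h (inf_eq_left.1 h'))
  have h1 := Submodule.finrank_lt_finrank_of_lt hlt
  have h2 : (A : Set V).ncard ≤ ((A ⊓ E : Submodule (ZMod q) V) : Set V).ncard +
      {v | v ∈ A ∧ v ∉ E}.ncard := by
    refine le_trans (Set.ncard_le_ncard ?_ (Set.toFinite _)) (Set.ncard_union_le _ _)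
    intro v hv
    by_cases hE : v ∈ E
    · left; exact ⟨hv, hE⟩
    · right; exact ⟨hv, hE⟩
  rw [hb_ncard q, hb_ncard q, hA] at h2
  have h3 : q ^ finrank (ZMod q) (A ⊓ E : Submodule (ZMod q) V) ≤ q ^ a :=
    Nat.pow_le_pow_right hq.pos (by omega)
  rw [Nat.sub_mul, one_mul, mul_comm q, ← pow_succ]
  omega

theorem hb_remove (q : ℕ) [Fact q.Prime] {V : Type*} [AddCommGroup V] [Module (ZMod q) V]
    [Finite V] (A : Set V) (hA0 : (0 : V) ∉ A) (K : Submodule (ZMod q) V)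
    (hKA : ∀ v ∈ K, v ≠ 0 → v ∈ A) :
    {v | v ∈ A ∧ v ∉ K}.ncard + q ^ finrank (ZMod q) K = A.ncard + 1 := by
  rw [← hb_ncard q K, ← Set.ncard_insert_of_notMem hA0 (Set.toFinite _),
    ← Set.ncard_union_eq _ (Set.toFinite _) (Set.toFinite _)]
  · congr 1
    ext v
    simp only [Set.mem_union, Set.mem_ofPred_eq, SetLike.mem_coe, Set.mem_insert_iff]
    constructor
    · rintro (h | h)
      · exact Or.inr h.1
      · by_cases h0 : v = 0
        · exact Or.inl h0
        · exact Or.inr (hKA v h h0)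
    · rintro (h | h)
      · right; rw [h]; exact K.zero_mem
      · by_cases h' : v ∈ K
        · exact Or.inr h'
        · exact Or.inl ⟨h, h'⟩
  · rw [Set.disjoint_left]
    rintro v ⟨_, h⟩ h'
    exact h h'

/-- The statement of the extension theorem for spaces of dimension `n`. -/
def HBExt.{u} (q i n : ℕ) : Prop :=
  ∀ (V : Type u) [AddCommGroup V] [Module (ZMod q) V] [Finite V]
    (_ : finrank (ZMod q) V = n) (S : Set V)
    (_ : HBCone q S) (_ : HBBlk q (i + 1) S) (K : Submodule (ZMod q) V)
    (_ : finrank (ZMod q) K = i + 1) (_ : ∀ v ∈ K, v ≠ 0 → v ∈ S)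
    (y1 : V →ₗ[ZMod q] ZMod q) (_ : y1 ≠ 0) (_ : K ≤ LinearMap.ker y1)
    (_ : {v | v ∈ S ∧ y1 v = 0 ∧ v ∉ K}.ncard < (q - 1) * q ^ i)
    (_ : 2 * {v | v ∈ S ∧ v ∉ K}.ncard < (q - 1) * q ^ i * (3 * q + 1)),
    ∃ D : Submodule (ZMod q) V, K ≤ D ∧ finrank (ZMod q) D = i + 2 ∧
      ∀ v ∈ D, v ≠ 0 → v ∈ S

theorem hb_claim.{u} (q : ℕ) [Fact q.Prime] (i n : ℕ) (ih : HBExt.{u} q i n)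
    (V : Type u) [AddCommGroup V] [Module (ZMod q) V] [Finite V]
    (hV : finrank (ZMod q) V = n + 1) (S : Set V)
    (hS : HBCone q S) (hB : HBBlk q (i + 1) S) (K : Submodule (ZMod q) V)
    (hK : finrank (ZMod q) K = i + 1) (hKS : ∀ v ∈ K, v ≠ 0 → v ∈ S)
    (hcard : 2 * {v | v ∈ S ∧ v ∉ K}.ncard < (q - 1) * q ^ i * (3 * q + 1))
    (P : V) (hP0 : P ≠ 0) (hPS : P ∉ S)
    (y1 : V →ₗ[ZMod q] ZMod q) (hy1 : y1 ≠ 0)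
    (hGy : K ⊔ Submodule.span (ZMod q) {P} ≤ LinearMap.ker y1)
    (hlight : {v | v ∈ S ∧ y1 v = 0 ∧ v ∉ K ⊔ Submodule.span (ZMod q) {P}}.ncard
      < (q - 1) * q ^ i) :
    ∃ E : Submodule (ZMod q) V, K ⊔ Submodule.span (ZMod q) {P} ≤ E ∧
      finrank (ZMod q) E = i + 3 ∧
      (q - 1) * q ^ (i + 1) ≤
        {v | v ∈ S ∧ v ∈ E ∧ v ∉ K ⊔ Submodule.span (ZMod q) {P}}.ncard := by
  set N := Submodule.span (ZMod q) {P} with hN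
  have hNf : finrank (ZMod q) N = 1 := finrank_span_singleton hP0
  have hNS : ∀ v ∈ N, v ∉ S := by
    intro v hv hvS
    obtain ⟨c, rfl⟩ := Submodule.mem_span_singleton.1 hv
    have hc : c ≠ 0 := by
      rintro rfl
      rw [zero_smul] at hvS
      exact hS.zero hvS
    have := hS.smul c⁻¹ _ (inv_ne_zero hc) hvS
    rw [smul_smul, inv_mul_cancel₀ hc, one_smul] at this
    exact hPS this
  have hVq : finrank (ZMod q) (V ⧸ N) = n := by
    have := Submodule.finrank_quotient_add_finrank N
    omega
  have hcomap : ∀ W : Submodule (ZMod q) (V ⧸ N),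
      finrank (ZMod q) (W.comap N.mkQ) = finrank (ZMod q) W + 1 := by
    intro W
    have h1 := LinearMap.finrank_range_add_finrank_ker (N.mkQ.domRestrict (W.comap N.mkQ))
    have h2 : LinearMap.range (N.mkQ.domRestrict (W.comap N.mkQ)) = W := by
      rw [LinearMap.range_domRestrict, Submodule.map_comap_eq, Submodule.range_mkQ, top_inf_eq]
    have h3 : finrank (ZMod q) (LinearMap.ker (N.mkQ.domRestrict (W.comap N.mkQ))) = 1 := by
      rw [LinearMap.ker_domRestrict, Submodule.ker_mkQ, ← hNf]
      exact (Submodule.comapSubtypeEquivOfLe (Submodule.le_comap_mkQ N W)).finrank_eq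
    rw [h2, h3] at h1
    exact h1.symm
  have hmem : ∀ v, N.mkQ v ∈ K.map N.mkQ ↔ v ∈ K ⊔ N := by
    intro v
    rw [← Submodule.mem_comap, Submodule.comap_map_mkQ, sup_comm]
  have hKf : finrank (ZMod q) (K.map N.mkQ) = i + 1 := by
    have hinj : Function.Injective (N.mkQ.domRestrict K) := by
      rw [← LinearMap.ker_eq_bot, LinearMap.ker_eq_bot']
      rintro ⟨v, hv⟩ h
      by_contra h0
      have hvN : v ∈ N := by
        rw [← Submodule.ker_mkQ N]; exact h
      exact hNS v hvN (hKS v hv (fun h' => h0 (Subtype.ext h')))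
    have := (LinearEquiv.ofInjective (N.mkQ.domRestrict K) hinj).finrank_eq
    rw [LinearMap.range_domRestrict] at this
    rw [← this, hK]
  have hfinq : Finite (V ⧸ N) := Finite.of_surjective N.mkQ (Submodule.mkQ_surjective N)
  have hyN : N ≤ LinearMap.ker y1 := le_sup_right.trans hGy
  obtain ⟨D, hKD, hDf, hDS⟩ := ih (V ⧸ N) hVq (N.mkQ '' S)
    ⟨by
      rintro ⟨v, hv, h⟩
      exact hNS v (by rw [← Submodule.ker_mkQ N]; exact h) hv,
    by
      rintro c _ hc ⟨v, hv, rfl⟩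
      exact ⟨c • v, hS.smul c v hc hv, map_smul _ _ _⟩⟩
    (by
      intro W hW
      obtain ⟨v, hv, hvS⟩ := hB (W.comap N.mkQ) (by rw [hcomap, hV]; omega)
      exact ⟨N.mkQ v, hv, v, hvS, rfl⟩)
    (K.map N.mkQ) hKf
    (by
      rintro _ ⟨v, hv, rfl⟩ h0
      refine ⟨v, hKS v hv ?_, rfl⟩
      rintro rfl
      exact h0 (map_zero _))
    (N.liftQ y1 hyN)
    (by
      intro h
      apply hy1
      rw [← N.liftQ_mkQ y1 hyN, h, LinearMap.zero_comp])
    (by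
      rintro _ ⟨v, hv, rfl⟩
      exact hGy (le_sup_left (a := K) hv))
    (by
      refine lt_of_le_of_lt ?_ hlight
      refine le_trans (Set.ncard_le_ncard ?_ (Set.toFinite _))
        (Set.ncard_image_le (f := N.mkQ) (Set.toFinite _))
      rintro _ ⟨⟨v, hv, rfl⟩, h1, h2⟩
      refine ⟨v, ⟨hv, h1, ?_⟩, rfl⟩
      rwa [← hmem])
    (by
      refine lt_of_le_of_lt (Nat.mul_le_mul_left 2 ?_) hcard
      refine le_trans (Set.ncard_le_ncard ?_ (Set.toFinite _))
        (Set.ncard_image_le (f := N.mkQ) (Set.toFinite _))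
      rintro _ ⟨⟨v, hv, rfl⟩, h1⟩
      refine ⟨v, ⟨hv, fun h => h1 ⟨v, h, rfl⟩⟩, rfl⟩)
  refine ⟨D.comap N.mkQ, ?_, ?_, ?_⟩
  · intro v hv
    exact hKD ((hmem v).2 hv)
  · rw [hcomap, hDf]
  · have hnle : ¬ D ≤ K.map N.mkQ := by
      intro h
      have := Submodule.finrank_mono h
      omega
    refine (hb_diff q D (K.map N.mkQ) (i + 1) hDf hnle).trans ?_
    refine le_trans (Set.ncard_le_ncard ?_ (Set.toFinite _))
        (Set.ncard_image_le (f := N.mkQ) (Set.toFinite _))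
    rintro x ⟨hxD, hxK⟩
    obtain ⟨v, hv, rfl⟩ := hDS x hxD (by rintro rfl; exact hxK (Submodule.zero_mem _))
    refine ⟨v, ⟨hv, hxD, ?_⟩, rfl⟩
    rwa [← hmem]

end Main

section Final
open Module

theorem hb_ext.{u} (q : ℕ) [Fact q.Prime] (hodd : Odd q) (i m : ℕ) :
    HBExt.{u} q i (i + 3 + m) := by
  have hq : q.Prime := Fact.out
  have hq2 : 2 ≤ q := hq.two_le
  induction m with
  | zero =>
    intro V _ _ _ hV S hS hB K hK hKS y1 hy1 hKy hlight hcard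
    exact hb_T_base q hodd i hV S hS hB K hK hKS y1 hy1 hKy hlight hcard
  | succ m ih =>
    intro V _ _ _ hV S hS hB K hK hKS y1 hy1 hKy hlight hcard
    by_contra hno
    have claim := hb_claim q i (i + 3 + m) ih V hV S hS hB K hK hKS hcard
    set M := (q - 1) * q ^ i with hM
    have hMq : (q - 1) * q ^ (i + 1) = M * q := by rw [hM, pow_succ, mul_assoc]
    have hM0 : 0 < M := Nat.mul_pos (by omega) (pow_pos hq.pos _)
    rw [hMq] at claim
    have hMle : M ≤ M * q := Nat.le_mul_of_pos_right _ hq.pos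
    -- two disjoint big parts are impossible
    have hfin : ∀ X Y : Set V, (∀ v ∈ X, v ∈ S ∧ v ∉ K) → (∀ v ∈ Y, v ∈ S ∧ v ∉ K) →
        (∀ v ∈ X, v ∉ Y) → M * q ≤ X.ncard → M * q ≤ Y.ncard → False := by
      intro X Y hX hY hXY h1 h2
      have h3 : X.ncard + Y.ncard ≤ {v | v ∈ S ∧ v ∉ K}.ncard := by
        rw [← Set.ncard_union_eq (Set.disjoint_left.2 hXY) (Set.toFinite _) (Set.toFinite _)]
        apply Set.ncard_le_ncard _ (Set.toFinite _)
        rintro v (h | h)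
        · exact hX v h
        · exact hY v h
      have h4 : M * (3 * q + 1) ≤ 4 * (M * q) := by
        calc M * (3 * q + 1) ≤ M * (4 * q) := Nat.mul_le_mul_left _ (by omega)
          _ = _ := by ring
      omega
    have hkerf : finrank (ZMod q) (LinearMap.ker y1) = (i + 2 + m) + 1 := by
      have := Module.Dual.finrank_ker_add_one_of_ne_zero hy1
      omega
    have hMle2 : M ≤ (q - 1) * q ^ (i + 2 + m) :=
      Nat.mul_le_mul_left _ (Nat.pow_le_pow_right hq.pos (by omega))
    -- choosing points in the light hyperplane
    have hchoose : ∀ E : Submodule (ZMod q) V, K ≤ E → ¬ LinearMap.ker y1 ≤ E →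
        ∃ P, P ∈ LinearMap.ker y1 ∧ P ∉ E ∧ P ∉ S := by
      intro E hKE hE
      by_contra hcon
      push Not at hcon
      have h1 := hb_diff q (LinearMap.ker y1) E (i + 2 + m) hkerf hE
      have h2 : {v | v ∈ LinearMap.ker y1 ∧ v ∉ E}.ncard ≤
          {v | v ∈ S ∧ y1 v = 0 ∧ v ∉ K}.ncard := by
        apply Set.ncard_le_ncard _ (Set.toFinite _)
        rintro v ⟨hv1, hv2⟩
        exact ⟨hcon v hv1 hv2, hv1, fun h => hv2 (hKE h)⟩
      omega
    have hstep : ∀ P ∈ LinearMap.ker y1, P ≠ 0 → P ∉ S →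
        ∃ E : Submodule (ZMod q) V, P ∈ E ∧ K ≤ E ∧ finrank (ZMod q) E = i + 3 ∧
          M * q ≤ {v | v ∈ S ∧ v ∈ E ∧ v ∉ K}.ncard := by
      intro P hP hP0 hPS
      have hGy : K ⊔ Submodule.span (ZMod q) {P} ≤ LinearMap.ker y1 :=
        sup_le hKy ((Submodule.span_singleton_le_iff_mem _ _).2 hP)
      obtain ⟨E, hE1, hE2, hE3⟩ := claim P hP0 hPS y1 hy1 hGy (by
        refine lt_of_le_of_lt ?_ hlight
        apply Set.ncard_le_ncard _ (Set.toFinite _)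
        rintro v ⟨h1, h2, h3⟩
        exact ⟨h1, h2, fun h => h3 (le_sup_left (a := K) h)⟩)
      refine ⟨E, hE1 ((le_sup_right (a := K)) (Submodule.mem_span_singleton_self P)),
        le_sup_left.trans hE1, hE2, hE3.trans ?_⟩
      apply Set.ncard_le_ncard _ (Set.toFinite _)
      rintro v ⟨h1, h2, h3⟩
      exact ⟨h1, h2, fun h => h3 (le_sup_left (a := K) h)⟩
    obtain ⟨P0, hP0H, hP0K, hP0S⟩ := hchoose K le_rfl (by
      intro h
      have := Submodule.finrank_mono h
      omega)
    obtain ⟨E0, hPE0, hKE0, hE0f, hE0c⟩ := hstep P0 hP0H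
      (by rintro rfl; exact hP0K K.zero_mem) hP0S
    have hE0H : ¬ E0 ≤ LinearMap.ker y1 := by
      intro h
      have : {v | v ∈ S ∧ v ∈ E0 ∧ v ∉ K}.ncard ≤ {v | v ∈ S ∧ y1 v = 0 ∧ v ∉ K}.ncard := by
        apply Set.ncard_le_ncard _ (Set.toFinite _)
        rintro v ⟨h1, h2, h3⟩
        exact ⟨h1, h h2, h3⟩
      omega
    obtain ⟨P1, hP1H, hP1E, hP1S⟩ := hchoose E0 hKE0 (by
      intro h
      have := Submodule.eq_of_le_of_finrank_le h (by omega)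
      exact hE0H this.ge)
    obtain ⟨E1, hPE1, hKE1, hE1f, hE1c⟩ := hstep P1 hP1H
      (by rintro rfl; exact hP1E E0.zero_mem) hP1S
    have hne : E0 ≠ E1 := by
      rintro rfl
      exact hP1E hPE1
    have hinf : ∀ A B : Submodule (ZMod q) V, A ≠ B → finrank (ZMod q) A = i + 3 →
        finrank (ZMod q) B = i + 3 →
        finrank (ZMod q) (A ⊓ B : Submodule (ZMod q) V) ≤ i + 2 := by
      intro A B hAB hA hB'
      have hlt : A ⊓ B < A := by
        refine lt_of_le_of_ne inf_le_left ?_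
        intro h
        exact hAB (Submodule.eq_of_le_of_finrank_le (inf_eq_left.1 h) (by omega))
      have := Submodule.finrank_lt_finrank_of_lt hlt
      omega
    have hKD : K ≤ E0 ⊓ E1 := le_inf hKE0 hKE1
    have hDle := hinf E0 E1 hne hE0f hE1f
    by_cases hDf : finrank (ZMod q) (E0 ⊓ E1 : Submodule (ZMod q) V) ≤ i + 1
    · have hDK := Submodule.eq_of_le_of_finrank_le hKD (by omega)
      refine hfin _ _ ?_ ?_ ?_ hE0c hE1c
      · rintro v ⟨h1, h2, h3⟩; exact ⟨h1, h3⟩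
      · rintro v ⟨h1, h2, h3⟩; exact ⟨h1, h3⟩
      · rintro v ⟨h1, h2, h3⟩ ⟨h4, h5, h6⟩
        apply h3
        rw [hDK]
        exact ⟨h2, h5⟩
    · set D := E0 ⊓ E1 with hD
      have hDf' : finrank (ZMod q) D = i + 2 := by omega
      obtain ⟨P, hPD, hP0, hPS⟩ : ∃ P, P ∈ D ∧ P ≠ 0 ∧ P ∉ S := by
        by_contra hcon
        push Not at hcon
        exact hno ⟨D, hKD, hDf', hcon⟩
      have hPK : P ∉ K := fun h => hPS (hKS P h hP0)
      have hG : K ⊔ Submodule.span (ZMod q) {P} = D := by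
        apply Submodule.eq_of_le_of_finrank_le
        · exact sup_le hKD ((Submodule.span_singleton_le_iff_mem _ _).2 hPD)
        · have hlt : K < K ⊔ Submodule.span (ZMod q) {P} := by
            refine lt_of_le_of_ne le_sup_left ?_
            intro h
            apply hPK
            rw [h]
            exact (le_sup_right (a := K)) (Submodule.mem_span_singleton_self P)
          have := Submodule.finrank_lt_finrank_of_lt hlt
          omega
      have hDE0 : D ≤ E0 := inf_le_left
      have hDE0lt : D < E0 := by
        refine lt_of_le_of_ne hDE0 ?_
        intro h
        rw [h] at hDf'
        omega
      obtain ⟨v0, hv0E, hv0D⟩ := SetLike.exists_of_lt hDE0lt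
      obtain ⟨f, hDker, hfv, hfc⟩ := hb_avg q D v0 hv0D {v | v ∈ S ∧ v ∉ E0} (by
        rintro t ⟨_, ht⟩ h
        exact ht ((sup_le hDE0 ((Submodule.span_singleton_le_iff_mem _ _).2 hv0E)) h))
      have hkE0 : ∀ t, t ∈ E0 → f t = 0 → t ∈ D := by
        have hlt : E0 ⊓ LinearMap.ker f < E0 := by
          refine lt_of_le_of_ne inf_le_left ?_
          intro h
          have : v0 ∈ E0 ⊓ LinearMap.ker f := by rw [h]; exact hv0E
          have h2 : f v0 = 0 := this.2
          rw [hfv] at h2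
          exact one_ne_zero h2
        have h1 := Submodule.finrank_lt_finrank_of_lt hlt
        have heq := Submodule.eq_of_le_of_finrank_le (le_inf hDE0 hDker) (by omega)
        intro t h2 h3
        rw [heq]
        exact ⟨h2, h3⟩
      have hsum : {v | v ∈ S ∧ v ∉ E0}.ncard + {v | v ∈ S ∧ v ∈ E0 ∧ v ∉ K}.ncard ≤
          {v | v ∈ S ∧ v ∉ K}.ncard := by
        rw [← Set.ncard_union_eq _ (Set.toFinite _) (Set.toFinite _)]
        · apply Set.ncard_le_ncard _ (Set.toFinite _)
          rintro v (⟨h1, h2⟩ | ⟨h1, h2, h3⟩)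
          · exact ⟨h1, fun h => h2 (hKE0 h)⟩
          · exact ⟨h1, h3⟩
        · rw [Set.disjoint_left]
          rintro v ⟨_, h2⟩ ⟨_, h3, _⟩
          exact h2 h3
      have hlt1 : {v | v ∈ S ∧ v ∉ E0}.ncard < M * q := by
        have e1 : M * (3 * q + 1) = 3 * (M * q) + M := by ring
        omega
      have hlight2 : {v | v ∈ S ∧ f v = 0 ∧ v ∉ D}.ncard < M := by
        have h1 : {v | v ∈ S ∧ f v = 0 ∧ v ∉ D}.ncard ≤
            {t | t ∈ {v | v ∈ S ∧ v ∉ E0} ∧ f t = 0}.ncard := by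
          apply Set.ncard_le_ncard _ (Set.toFinite _)
          rintro v ⟨h1, h2, h3⟩
          exact ⟨⟨h1, fun h => h3 (hkE0 v h h2)⟩, h2⟩
        have h2 := Nat.mul_le_mul_left q h1
        have h3 : q * {v | v ∈ S ∧ f v = 0 ∧ v ∉ D}.ncard < q * M := by
          rw [mul_comm q M]; omega
        exact lt_of_mul_lt_mul_left h3 (Nat.zero_le _)
      have claimP := claim P hP0 hPS f
      rw [hG] at claimP
      obtain ⟨E, hDE, hEf, hEc⟩ := claimP (by rintro rfl; simp at hfv) hDker hlight2
      have hend : ∀ A : Submodule (ZMod q) V, D ≤ A → finrank (ZMod q) A = i + 3 →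
          M * q ≤ {v | v ∈ S ∧ v ∈ A ∧ v ∉ K}.ncard → A ≠ E → False := by
        intro A hDA hAf hAc hAE
        have h1 := hinf A E hAE hAf hEf
        have h2 := Submodule.eq_of_le_of_finrank_le (le_inf hDA hDE) (by omega)
        refine hfin _ _ ?_ ?_ ?_ hAc hEc
        · rintro v ⟨h1, h2, h3⟩; exact ⟨h1, h3⟩
        · rintro v ⟨h1, h2, h3⟩; exact ⟨h1, fun h => h3 (hKD h)⟩
        · rintro v ⟨h3, h4, h5⟩ ⟨h6, h7, h8⟩
          apply h8
          rw [h2]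
          exact ⟨h4, h7⟩
      by_cases h0 : E0 = E
      · exact hend E1 inf_le_right hE1f hE1c (fun h => hne (h0.trans h.symm))
      · exact hend E0 hDE0 hE0f hE0c h0

theorem hb_main.{u} (q : ℕ) [Fact q.Prime] (hodd : Odd q) (k : ℕ) :
    ∀ (V : Type u) [AddCommGroup V] [Module (ZMod q) V] [Finite V] (S : Set V),
      HBCone q S → HBBlk q k S → k + 1 ≤ finrank (ZMod q) V →
      2 * (q * S.ncard) + 2 * q < 2 * q ^ (k + 2) + (q - 1) * q ^ k * (q + 1) →
      ∃ D : Submodule (ZMod q) V, finrank (ZMod q) D = k + 1 ∧ ∀ v ∈ D, v ≠ 0 → v ∈ S := by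
  have hq : q.Prime := Fact.out
  have hq2 : 2 ≤ q := hq.two_le
  have hspan : ∀ (V : Type u) [AddCommGroup V] [Module (ZMod q) V] (S : Set V),
      HBCone q S → ∀ u v : V, u ∈ Submodule.span (ZMod q) {v} → u ≠ 0 → v ∈ S → u ∈ S := by
    intro V _ _ S hS u v hu hu0 hv
    obtain ⟨c, rfl⟩ := Submodule.mem_span_singleton.1 hu
    apply hS.smul _ _ _ hv
    rintro rfl
    simp at hu0
  induction k with
  | zero =>
    intro V _ _ _ S hS hB hV _
    obtain ⟨v, -, hv⟩ := hB ⊤ (by rw [finrank_top]; omega)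
    have hv0 : v ≠ 0 := by rintro rfl; exact hS.zero hv
    exact ⟨Submodule.span (ZMod q) {v}, finrank_span_singleton hv0,
      fun u hu hu0 => hspan V S hS u v hu hu0 hv⟩
  | succ i ih =>
    intro V _ _ _ S hS hB hV hc
    have hc' : 2 * S.ncard + 2 < 2 * q ^ (i + 2) + (q - 1) * q ^ i * (q + 1) := by
      have : q * (2 * S.ncard + 2) < q * (2 * q ^ (i + 2) + (q - 1) * q ^ i * (q + 1)) := by
        calc q * (2 * S.ncard + 2) = 2 * (q * S.ncard) + 2 * q := by ring
          _ < _ := hc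
          _ = _ := by ring
      exact lt_of_mul_lt_mul_left this (Nat.zero_le _)
    by_cases hn : finrank (ZMod q) V = i + 2
    · refine ⟨⊤, by rw [finrank_top, hn], ?_⟩
      intro v _ hv0
      obtain ⟨u, hu, huS⟩ := hB (Submodule.span (ZMod q) {v}) (by
        rw [finrank_span_singleton hv0]; omega)
      have hu0 : u ≠ 0 := by rintro rfl; exact hS.zero huS
      refine hspan V S hS v u ?_ hv0 huS
      obtain ⟨c, rfl⟩ := Submodule.mem_span_singleton.1 hu
      have hc0 : c ≠ 0 := by rintro rfl; simp at hu0
      exact Submodule.mem_span_singleton.2 ⟨c⁻¹, by rw [smul_smul, inv_mul_cancel₀ hc0, one_smul]⟩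
    obtain ⟨v, -, hv⟩ := hB ⊤ (by rw [finrank_top]; omega)
    have hv0 : v ≠ 0 := by rintro rfl; exact hS.zero hv
    obtain ⟨f, -, hfv, hfc⟩ := hb_avg q ⊥ v (by simpa using hv0)
      {t | t ∈ S ∧ t ∉ Submodule.span (ZMod q) {v}} (by
        rintro t ⟨_, ht⟩
        rwa [bot_sup_eq])
    have hTc := hb_remove q S hS.zero (Submodule.span (ZMod q) {v})
      (fun u hu hu0 => hspan V S hS u v hu hu0 hv)
    rw [finrank_span_singleton hv0, pow_one] at hTc
    have hf0 : f ≠ 0 := by rintro rfl; simp at hfv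
    have hkf := Module.Dual.finrank_ker_add_one_of_ne_zero hf0
    set H : Set V := {t | t ∈ S ∧ f t = 0} with hH
    have hHle : H.ncard ≤ {t | t ∈ {t | t ∈ S ∧ t ∉ Submodule.span (ZMod q) {v}} ∧
        f t = 0}.ncard := by
      apply Set.ncard_le_ncard _ (Set.toFinite _)
      rintro t ⟨h1, h2⟩
      refine ⟨⟨h1, ?_⟩, h2⟩
      intro h3
      obtain ⟨c, rfl⟩ := Submodule.mem_span_singleton.1 h3
      rw [map_smul, hfv, smul_eq_mul, mul_one] at h2
      rw [h2, zero_smul] at h1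
      exact hS.zero h1
    have hHq : q * H.ncard + q ≤ S.ncard + 1 := by
      have := Nat.mul_le_mul_left q hHle
      omega
    have hHb : 2 * (q * H.ncard) + 2 * q < 2 * q ^ (i + 2) + (q - 1) * q ^ i * (q + 1) := by
      omega
    -- the induction hypothesis in the hyperplane
    set S' : Set (LinearMap.ker f) := {x | (x : V) ∈ S} with hS'
    have hS'c : S'.ncard ≤ H.ncard := by
      apply Set.ncard_le_ncard_of_injOn (fun x : LinearMap.ker f => (x : V)) _ _ (Set.toFinite _)
      · intro x hx
        exact ⟨hx, x.2⟩
      · intro a _ b _ h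
        exact Subtype.ext h
    obtain ⟨K', hK'f, hK'S⟩ := ih (LinearMap.ker f) S'
      ⟨fun h => hS.zero h, fun c x hc hx => hS.smul c x hc hx⟩
      (by
        intro W hW
        have hWf : finrank (ZMod q) (W.map (LinearMap.ker f).subtype) = finrank (ZMod q) W :=
          LinearEquiv.finrank_eq (Submodule.equivMapOfInjective _
            (Submodule.subtype_injective _) W).symm
        obtain ⟨u, ⟨x, hx, rfl⟩, hu⟩ := hB (W.map (LinearMap.ker f).subtype) (by
          rw [hWf]; omega)
        exact ⟨x, hx, hu⟩)
      (by omega)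
      (by
        have := Nat.mul_le_mul_left q hS'c
        omega)
    set K := K'.map (LinearMap.ker f).subtype with hKdef
    have hKf : finrank (ZMod q) K = i + 1 := by
      rw [← hK'f]
      exact LinearEquiv.finrank_eq (Submodule.equivMapOfInjective _
            (Submodule.subtype_injective _) K').symm
    have hKker : K ≤ LinearMap.ker f := by
      rintro _ ⟨x, _, rfl⟩
      exact x.2
    have hKS : ∀ u ∈ K, u ≠ 0 → u ∈ S := by
      rintro _ ⟨x, hx, rfl⟩ h0
      exact hK'S x hx (by rintro rfl; exact h0 (map_zero _))
    have r1 := hb_remove q S hS.zero K hKS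
    have r2 := hb_remove q H (fun h => hS.zero h.1) K (fun u hu hu0 => ⟨hKS u hu hu0, hKker hu⟩)
    rw [hKf] at r1 r2
    have e2 : {v | v ∈ H ∧ v ∉ K} = {v | v ∈ S ∧ f v = 0 ∧ v ∉ K} := by
      ext u
      exact and_assoc
    rw [e2] at r2
    obtain ⟨p, hp⟩ : ∃ p, q = p + 1 := ⟨q - 1, by omega⟩
    have hlight : {v | v ∈ S ∧ f v = 0 ∧ v ∉ K}.ncard < (q - 1) * q ^ i := by
      have : H.ncard + 1 < q ^ (i + 1) + (q - 1) * q ^ i := by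
        have h1 : 2 * q * (H.ncard + 1) < 2 * q * (q ^ (i + 1) + (q - 1) * q ^ i) := by
          calc 2 * q * (H.ncard + 1) = 2 * (q * H.ncard) + 2 * q := by ring
            _ < 2 * q ^ (i + 2) + (q - 1) * q ^ i * (q + 1) := hHb
            _ ≤ 2 * q ^ (i + 2) + (q - 1) * q ^ i * (2 * q) := by gcongr; omega
            _ = _ := by ring
        exact lt_of_mul_lt_mul_left h1 (Nat.zero_le _)
      omega
    have hcard : 2 * {v | v ∈ S ∧ v ∉ K}.ncard < (q - 1) * q ^ i * (3 * q + 1) := by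
      have e3 : 2 * q ^ (i + 2) + (q - 1) * q ^ i * (q + 1) =
          2 * q ^ (i + 1) + (q - 1) * q ^ i * (3 * q + 1) := by
        rw [hp, Nat.add_sub_cancel]; ring
      omega
    obtain ⟨m, hm⟩ : ∃ m, finrank (ZMod q) V = i + 3 + m :=
      ⟨finrank (ZMod q) V - (i + 3), by omega⟩
    obtain ⟨D, -, hD1, hD2⟩ := hb_ext.{u} q hodd i m V hm S hS hB K hKf hKS f hf0 hKker hlight hcard
    exact ⟨D, hD1, hD2⟩

end Final

/-- **Proposition (Heim).** A `k`-blocking set of `PG(F_q^n)` (`n > k`, `n ≥ 3`) not containing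
the point set of any `k`-space has at least `(q^{k+1}-1)/(q-1) + q^{k-1}(q+1)/2` points. -/
theorem stmt13 (q n k : ℕ) (hq : q.Prime) (hodd : Odd q) (hk : 1 ≤ k) (hkn : k < n)
    (hn : 3 ≤ n)
    (B : Set (Submodule (ZMod q) (Fin n → ZMod q))) (hB : IsBlockingSet q n k B)
    (hnoK : ¬ ∃ W : Submodule (ZMod q) (Fin n → ZMod q),
        Module.finrank (ZMod q) W = k + 1 ∧ {P | ∃ v ∈ W, v ≠ 0 ∧ P = projPoint v} ⊆ B) :
    (∑ i ∈ Finset.range (k + 1), q ^ i) + q ^ (k - 1) * ((q + 1) / 2) ≤ B.ncard := by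
  classical
  have : Fact q.Prime := ⟨hq⟩
  by_contra hcon
  rw [not_le] at hcon
  have hq2 : 2 ≤ q := hq.two_le
  set S : Set (Fin n → ZMod q) := {v | v ≠ 0 ∧ projPoint v ∈ B} with hSdef
  have hS : HBCone q S := by
    refine ⟨fun h => h.1 rfl, ?_⟩
    rintro c v hc ⟨hv0, hv⟩
    refine ⟨smul_ne_zero hc hv0, ?_⟩
    have : projPoint (c • v) = projPoint v :=
      Submodule.span_singleton_smul_eq (IsUnit.mk0 c hc) v
    rwa [this]
  have hVf : Module.finrank (ZMod q) (Fin n → ZMod q) = n := by simp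
  have hBlk : HBBlk q k S := by
    intro W hW
    rw [hVf] at hW
    obtain ⟨W', hW'W, hW'f⟩ : ∃ W' : Submodule (ZMod q) (Fin n → ZMod q), W' ≤ W ∧
        Module.finrank (ZMod q) W' = n - k := by
      have hle : n - k ≤ Module.finrank (ZMod q) W := by omega
      have hli := ((Module.finBasis (ZMod q) W).linearIndependent.comp (Fin.castLE hle)
        (Fin.castLE_injective hle)).map' W.subtype (Submodule.ker_subtype W)
      refine ⟨Submodule.span (ZMod q) (Set.range (W.subtype ∘
        (Module.finBasis (ZMod q) W) ∘ Fin.castLE hle)), ?_, ?_⟩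
      · rw [Submodule.span_le]
        rintro _ ⟨j, rfl⟩
        exact Subtype.prop _
      · rw [finrank_span_eq_card hli, Fintype.card_fin]
    obtain ⟨v, hv, hv0, hvB⟩ := hB W' hW'f
    exact ⟨v, hW'W hv, hv0, hvB⟩
  have hfinB : B.Finite := by
    have : Finite (Submodule (ZMod q) (Fin n → ZMod q)) :=
      Finite.of_injective (fun W => (W : Set (Fin n → ZMod q))) SetLike.coe_injective
    exact Set.toFinite B
  have hScard : S.ncard ≤ (q - 1) * B.ncard := by
    have fS := Set.toFinite S
    rw [Set.ncard_eq_toFinset_card S fS]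
    refine (Finset.card_le_mul_card_image (f := projPoint) fS.toFinset (q - 1) ?_).trans ?_
    · intro a ha
      obtain ⟨v, hv, rfl⟩ := Finset.mem_image.1 ha
      rw [Set.Finite.mem_toFinset] at hv
      have hc := hb_ncard q (projPoint v)
      have hf1 : Module.finrank (ZMod q) (projPoint v) = 1 := finrank_span_singleton hv.1
      rw [hf1, pow_one] at hc
      have hle : {u | u ∈ projPoint v ∧ u ≠ 0}.ncard + 1 ≤ q := by
        rw [← Set.ncard_insert_of_notMem (a := 0) (fun h => h.2 rfl) (Set.toFinite _)]
        refine le_trans (Set.ncard_le_ncard ?_ (Set.toFinite _)) hc.le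
        rintro u (rfl | h)
        · exact Submodule.zero_mem _
        · exact h.1
      have hle2 : (fS.toFinset.filter (fun x => projPoint x = projPoint v)).card ≤
          {u | u ∈ projPoint v ∧ u ≠ 0}.ncard := by
        rw [← Set.ncard_coe_finset]
        apply Set.ncard_le_ncard _ (Set.toFinite _)
        intro u hu
        rw [Finset.mem_coe, Finset.mem_filter, Set.Finite.mem_toFinset] at hu
        refine ⟨?_, hu.1.1⟩
        rw [← hu.2]
        exact Submodule.mem_span_singleton_self u
      omega
    · apply Nat.mul_le_mul_left
      rw [← Set.ncard_coe_finset]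
      apply Set.ncard_le_ncard _ hfinB
      intro P hP
      rw [Finset.mem_coe, Finset.mem_image] at hP
      obtain ⟨v, hv, rfl⟩ := hP
      rw [Set.Finite.mem_toFinset] at hv
      exact hv.2
  obtain ⟨i, rfl⟩ : ∃ i, k = i + 1 := ⟨k - 1, by omega⟩
  obtain ⟨D, hDf, hDS⟩ := hb_main q hodd (i + 1) (Fin n → ZMod q) S hS hBlk (by rw [hVf]; omega) (by
    obtain ⟨p, hp⟩ : ∃ p, q = p + 1 := ⟨q - 1, by omega⟩
    obtain ⟨s, hs⟩ : ∃ s, q + 1 = 2 * s := by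
      obtain ⟨m, hm⟩ := hodd
      exact ⟨m + 1, by omega⟩
    have hs2 : (q + 1) / 2 = s := by omega
    rw [hs2, Nat.add_sub_cancel] at hcon
    have hgeom : (∑ j ∈ Finset.range (i + 1 + 1), q ^ j) * p + 1 = q ^ (i + 2) := by
      rw [hp]; exact geom_sum_mul_add p (i + 2)
    have hp1 : q - 1 = p := by omega
    rw [hp1] at hScard ⊢
    have h1 := Nat.mul_le_mul_left p (Nat.succ_le_of_lt hcon)
    set G := ∑ j ∈ Finset.range (i + 1 + 1), q ^ j with hG
    have h2 : p * (G + q ^ i * s) = G * p + p * q ^ i * s := by ring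
    rw [h2, Nat.succ_eq_add_one, Nat.mul_add, mul_one] at h1
    have h3 : 2 * S.ncard + 2 < 2 * q ^ (i + 2) + 2 * (p * q ^ i * s) := by omega
    calc 2 * (q * S.ncard) + 2 * q = q * (2 * S.ncard + 2) := by ring
      _ < q * (2 * q ^ (i + 2) + 2 * (p * q ^ i * s)) := by
        exact Nat.mul_lt_mul_of_pos_left h3 hq.pos
      _ = 2 * q ^ (i + 1 + 2) + p * q ^ (i + 1) * (q + 1) := by
        rw [hs]; ring)
  apply hnoK
  refine ⟨D, hDf, ?_⟩
  rintro _ ⟨v, hv, hv0, rfl⟩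
  exact (hDS v hv hv0).2
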